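/- Let f : [0,1] → ℝ^d be continuous and suppose there exists M > 0 such that for every a ∈ ℝ^d, min_{0≤t≤1} a′f(t) ≤ −M‖a‖. Then K = {y ∈ ℝ^d : min_{0≤t≤1}(1 + y′f(t)) > 0} is an open, bounded, convex subset of ℝ^d containing 0_d, the set K̄ = {y ∈ ℝ^d : min_{0≤t≤1}(1 + y′f(t)) ≥ 0} is closed, bounded and convex, and K̄ equals the closure of K. (Deterministic ingredient of Theorem 1, valid on the probability-one event produced by Lemma 1(iv).) -/

import Mathlib

open MeasureTheory Filter Set Topology
open scoped RealInnerProductSpace ENNReal NNReal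

noncomputable section

/-- The open set `K_d = {y : min_{0≤t≤1} (1 + y′φ(t)) > 0}` associated with a path `φ`. -/
def KO {d : ℕ} (φ : ℝ → EuclideanSpace ℝ (Fin d)) : Set (EuclideanSpace ℝ (Fin d)) :=
  {y | ∀ t ∈ Set.Icc (0 : ℝ) 1, 0 < 1 + ⟪y, φ t⟫}

/-- The set `K̄_d = {y : min_{0≤t≤1} (1 + y′φ(t)) ≥ 0}` associated with a path `φ`. -/
def KC {d : ℕ} (φ : ℝ → EuclideanSpace ℝ (Fin d)) : Set (EuclideanSpace ℝ (Fin d)) :=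
  {y | ∀ t ∈ Set.Icc (0 : ℝ) 1, 0 ≤ 1 + ⟪y, φ t⟫}

/-- The real-valued function `g_d(a) = −∫₀¹ log(1 + a′φ(t)) dt`. -/
def gR {d : ℕ} (φ : ℝ → EuclideanSpace ℝ (Fin d)) (a : EuclideanSpace ℝ (Fin d)) : ℝ :=
  -∫ t in Set.Icc (0 : ℝ) 1, Real.log (1 + ⟪a, φ t⟫)

open scoped Classical in
/-- The `(−∞, +∞]`-valued function `g_d(a) = −∫₀¹ log(1 + a′φ(t)) dt`, equal to `+∞`
precisely when `t ↦ log(1 + a′φ(t))` is not integrable on `[0,1]` (on `K̄_d` the integrand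
is bounded above, so non-integrability means the integral diverges to `−∞`). -/
def gE {d : ℕ} (φ : ℝ → EuclideanSpace ℝ (Fin d)) (a : EuclideanSpace ℝ (Fin d)) : EReal :=
  if IntegrableOn (fun t => Real.log (1 + ⟪a, φ t⟫)) (Set.Icc (0 : ℝ) 1) volume
  then ((gR φ a : ℝ) : EReal) else ⊤

theorem KO_subset_KC {d : ℕ} (φ : ℝ → EuclideanSpace ℝ (Fin d)) : KO φ ⊆ KC φ :=
  fun _ hy t ht => (hy t ht).le

theorem zero_mem_KO {d : ℕ} (φ : ℝ → EuclideanSpace ℝ (Fin d)) : 0 ∈ KO φ :=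
  fun t _ => by simp

theorem convex_KO {d : ℕ} (φ : ℝ → EuclideanSpace ℝ (Fin d)) : Convex ℝ (KO φ) := by
  refine convex_iff_forall_pos.2 fun x hx y hy a b ha hb hab t ht => ?_
  rw [inner_add_left, real_inner_smul_left, real_inner_smul_left]
  nlinarith [mul_pos ha (hx t ht), mul_pos hb (hy t ht)]

theorem convex_KC {d : ℕ} (φ : ℝ → EuclideanSpace ℝ (Fin d)) : Convex ℝ (KC φ) := by
  refine convex_iff_forall_pos.2 fun x hx y hy a b ha hb hab t ht => ?_
  rw [inner_add_left, real_inner_smul_left, real_inner_smul_left]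
  nlinarith [mul_nonneg ha.le (hx t ht), mul_nonneg hb.le (hy t ht)]

theorem isClosed_KC {d : ℕ} (φ : ℝ → EuclideanSpace ℝ (Fin d)) : IsClosed (KC φ) := by
  simp only [KC, ofPred_forall]
  exact isClosed_biInter fun t _ => isClosed_le continuous_const (by fun_prop)

theorem isOpen_KO {d : ℕ} {φ : ℝ → EuclideanSpace ℝ (Fin d)}
    (hφ : ContinuousOn φ (Set.Icc 0 1)) : IsOpen (KO φ) := by
  refine Metric.isOpen_iff.2 fun y hy => ?_
  obtain ⟨C, hC⟩ := isCompact_Icc.exists_bound_of_continuousOn hφ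
  obtain ⟨s, hs, hmin⟩ := isCompact_Icc.exists_isMinOn (nonempty_Icc.2 zero_le_one)
    (by fun_prop :
      ContinuousOn (fun t => 1 + ⟪y, φ t⟫) (Set.Icc 0 1))
  have hC0 : 0 < |C| + 1 := by positivity
  refine ⟨(1 + ⟪y, φ s⟫) / (|C| + 1), div_pos (hy s hs) hC0, fun z hz t ht => ?_⟩
  rw [mem_ball_iff_norm, lt_div_iff₀ hC0] at hz
  have hle : 1 + ⟪y, φ s⟫ ≤ 1 + ⟪y, φ t⟫ := hmin ht
  have hb : ‖φ t‖ ≤ |C| + 1 := by linarith [hC t ht, le_abs_self C]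
  have hdiff : -(‖z - y‖ * ‖φ t‖) ≤ ⟪z - y, φ t⟫ :=
    neg_le_of_abs_le (abs_real_inner_le_norm _ _)
  rw [inner_sub_left] at hdiff
  linarith [mul_le_mul_of_nonneg_left hb (norm_nonneg (z - y))]

theorem isBounded_KC {d : ℕ} {φ : ℝ → EuclideanSpace ℝ (Fin d)} {M : ℝ} (hM : 0 < M)
    (h : ∀ a : EuclideanSpace ℝ (Fin d), ∃ t ∈ Set.Icc (0 : ℝ) 1, ⟪a, φ t⟫ ≤ -M * ‖a‖) :
    Bornology.IsBounded (KC φ) := by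
  refine isBounded_iff_forall_norm_le.2 ⟨1 / M, fun y hy => ?_⟩
  obtain ⟨t, ht, hle⟩ := h y
  rw [le_div_iff₀ hM]
  linarith [hy t ht]

theorem closure_KO {d : ℕ} (φ : ℝ → EuclideanSpace ℝ (Fin d)) : closure (KO φ) = KC φ := by
  refine (closure_minimal (KO_subset_KC φ) (isClosed_KC φ)).antisymm fun y hy => ?_
  have h1 : (1 : ℝ) ∈ closure (Ico 0 1) := by
    rw [closure_Ico zero_ne_one]
    exact right_mem_Icc.2 zero_le_one
  have hmaps : MapsTo (fun s : ℝ => s • y) (Ico 0 1) (KO φ) := fun s hs t ht => by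
    rw [real_inner_smul_left]
    nlinarith [mul_nonneg hs.1 (hy t ht), hs.2]
  simpa using map_mem_closure (by fun_prop) h1 hmaps

/-- Deterministic ingredient of Theorem 1: if `f : [0,1] → ℝ^d` is continuous and
`min_{0≤t≤1} a′f(t) ≤ −M‖a‖` for all `a` and some `M > 0`, then `K` is open, bounded and
convex with `0 ∈ K`, `K̄` is closed, bounded and convex, and `K̄` is the closure of `K`. -/
theorem theorem1_sets {d : ℕ} (hd : 0 < d) (f : ℝ → EuclideanSpace ℝ (Fin d))
    (hf : ContinuousOn f (Set.Icc 0 1))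
    (hM : ∃ M : ℝ, 0 < M ∧ ∀ a : EuclideanSpace ℝ (Fin d),
      ∃ t ∈ Set.Icc (0 : ℝ) 1, ⟪a, f t⟫ ≤ -M * ‖a‖) :
    IsOpen (KO f) ∧ Bornology.IsBounded (KO f) ∧ Convex ℝ (KO f) ∧
    (0 : EuclideanSpace ℝ (Fin d)) ∈ KO f ∧
    IsClosed (KC f) ∧ Bornology.IsBounded (KC f) ∧ Convex ℝ (KC f) ∧
    closure (KO f) = KC f := by
  obtain ⟨M, hM0, hM⟩ := hM
  have hb := isBounded_KC hM0 hM
  exact ⟨isOpen_KO hf, hb.subset (KO_subset_KC f), convex_KO f, zero_mem_KO f,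
    isClosed_KC f, hb, convex_KC f, closure_KO f⟩
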